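/- Let 𝔽_q be a finite field, let B ∈ 𝔽_q[T] be nonzero, and let ω := e^{2πi/3}. Define W_d(B) := ∑_D ω^{deg(D)}, where the sum runs over all monic cube-free D ∈ 𝔽_q[T] coprime to B with deg(rad(D)) = d. Let P ∈ 𝔽_q[T] be monic irreducible of degree m with P ∤ B. Then for every d ≥ 0: W_d(P·B) = ∑_{a=0}^{⌊d/m⌋} (−1)^a · (ω^m + ω^{2m})^a · W_{d − a·m}(B). -/

import Mathlib

open Polynomial UniqueFactorizationMonoid

/-- `D` is cube-free: no monic irreducible polynomial `P` satisfies `P³ ∣ D`. -/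
def Polynomial.CubeFree {Fq : Type*} [Field Fq] (D : Fq[X]) : Prop :=
  ∀ P : Fq[X], P.Monic → Irreducible P → ¬P ^ 3 ∣ D

/-- `deg(rad D)`: the sum of the degrees of the distinct monic irreducible divisors of `D`. -/
noncomputable def Polynomial.radDeg {Fq : Type*} [Field Fq] [DecidableEq Fq] (D : Fq[X]) : ℕ :=
  ∑ P ∈ (normalizedFactors D).toFinset, P.natDegree

/-- `W_d(B) = ∑_D ω^{deg D}`, the sum over monic cube-free `D` coprime to `B` with
`deg(rad D) = d`, where `ω = e^{2πi/3}`. -/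
noncomputable def cubeFreeWeightedSum {Fq : Type*} [Field Fq] [DecidableEq Fq]
    (B : Fq[X]) (d : ℕ) : ℂ :=
  ∑ᶠ D ∈ {D : Fq[X] | D.Monic ∧ D.CubeFree ∧ IsCoprime D B ∧ D.radDeg = d},
    Complex.exp (2 * Real.pi * Complex.I / 3) ^ D.natDegree

namespace Polynomial

variable {Fq : Type*} [Field Fq]

theorem CubeFree.of_dvd {D E : Fq[X]} (hD : D.CubeFree) (h : E ∣ D) : E.CubeFree :=
  fun Q hQ hQi hQE => hD Q hQ hQi (hQE.trans h)

theorem CubeFree.pow_mul {P D : Fq[X]} (hD : D.CubeFree) (hP : P.Monic) (hirr : Irreducible P)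
    (hPD : ¬P ∣ D) {k : ℕ} (hk : k < 3) : (P ^ k * D).CubeFree := by
  intro Q hQ hQi hdvd
  by_cases hQP : Q = P
  · subst hQP
    obtain ⟨j, hj⟩ := Nat.exists_eq_add_of_lt hk
    rw [hj, add_assoc, pow_add] at hdvd
    have h := (mul_dvd_mul_iff_left (pow_ne_zero k hirr.ne_zero)).1 hdvd
    exact hPD ((dvd_pow_self Q (Nat.succ_ne_zero j)).trans h)
  · have hcop : IsCoprime Q P := by
      refine (hQi.coprime_iff_not_dvd).2 fun h => hQP ?_
      exact eq_of_monic_of_associated hQ hP (hQi.associated_of_dvd hirr h)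
    exact hD Q hQ hQi (hcop.pow.dvd_of_dvd_mul_left hdvd)

theorem finite_setOf_natDegree_le [Finite Fq] (n : ℕ) : {D : Fq[X] | D.natDegree ≤ n}.Finite := by
  have : Finite (degreeLT Fq (n + 1)) := Finite.of_equiv _ (degreeLTEquiv Fq (n + 1)).symm.toEquiv
  refine (Set.toFinite (degreeLT Fq (n + 1) : Set Fq[X])).subset fun D hD => ?_
  rw [SetLike.mem_coe, mem_degreeLT]
  exact degree_le_natDegree.trans_lt (by exact_mod_cast Nat.lt_succ_of_le hD)

variable [DecidableEq Fq]

theorem radDeg_pow_mul {P D : Fq[X]} (hP : P.Monic) (hirr : Irreducible P) (hD : D ≠ 0)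
    (hPD : ¬P ∣ D) {k : ℕ} (hk : k ≠ 0) : (P ^ k * D).radDeg = D.radDeg + P.natDegree := by
  have hmem : P ∉ (normalizedFactors D).toFinset := fun h =>
    hPD (dvd_of_mem_normalizedFactors (Multiset.mem_toFinset.1 h))
  unfold radDeg
  rw [normalizedFactors_mul (pow_ne_zero k hirr.ne_zero) hD, normalizedFactors_pow,
    normalizedFactors_irreducible hirr, hP.normalize_eq_self, Multiset.toFinset_add,
    Multiset.toFinset_nsmul _ _ hk, Multiset.toFinset_singleton, ← Finset.insert_eq,
    Finset.sum_insert hmem, add_comm]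

theorem CubeFree.natDegree_le {D : Fq[X]} (hD : D.CubeFree) (hm : D.Monic) :
    D.natDegree ≤ 2 * D.radDeg := by
  have hprod : (normalizedFactors D).prod = D := by
    rw [prod_normalizedFactors_eq hm.ne_zero, hm.normalize_eq_self]
  have hdeg : D.natDegree = ((normalizedFactors D).map natDegree).sum := by
    conv_lhs => rw [← hprod]
    exact natDegree_multiset_prod _ (zero_notMem_normalizedFactors D)
  rw [hdeg, Finset.sum_multiset_map_count, radDeg, Finset.mul_sum]
  refine Finset.sum_le_sum fun Q hQ => ?_
  rw [Multiset.mem_toFinset] at hQ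
  rw [smul_eq_mul]
  refine Nat.mul_le_mul_right _ ?_
  by_contra! h
  have hQi := irreducible_of_normalized_factor Q hQ
  have hQm : Q.Monic := by
    rw [← normalize_normalized_factor Q hQ]
    exact monic_normalize hQi.ne_zero
  refine hD Q hQm hQi ?_
  rw [← hprod, ← Multiset.prod_replicate]
  exact Multiset.prod_dvd_prod_of_le (Multiset.le_count_iff_replicate_le.1 h)

theorem finite_setOf_cubeFree_radDeg [Finite Fq] (B : Fq[X]) (d : ℕ) :
    {D : Fq[X] | D.Monic ∧ D.CubeFree ∧ IsCoprime D B ∧ D.radDeg = d}.Finite :=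
  (finite_setOf_natDegree_le (2 * d)).subset fun _ ⟨hm, hc, _, hr⟩ => hr ▸ hc.natDegree_le hm

/-- Sorting the monic cube-free polynomials coprime to `B` by the exact power of `P`
dividing them. -/
theorem setOf_cubeFree_eq_union {B P : Fq[X]} (hP : P.Monic) (hirr : Irreducible P)
    (hPB : ¬P ∣ B) (d : ℕ) :
    {D : Fq[X] | D.Monic ∧ D.CubeFree ∧ IsCoprime D B ∧ D.radDeg = d} =
      {D : Fq[X] | D.Monic ∧ D.CubeFree ∧ IsCoprime D (P * B) ∧ D.radDeg = d} ∪
        ((fun D => P ^ 1 * D) '' {D : Fq[X] | D.Monic ∧ D.CubeFree ∧ IsCoprime D (P * B) ∧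
            D.radDeg + P.natDegree = d} ∪
          (fun D => P ^ 2 * D) '' {D : Fq[X] | D.Monic ∧ D.CubeFree ∧ IsCoprime D (P * B) ∧
            D.radDeg + P.natDegree = d}) := by
  have hcop : IsCoprime P B := hirr.coprime_iff_not_dvd.2 hPB
  have hback : ∀ k : ℕ, k ≠ 0 → k < 3 → ∀ D : Fq[X], D.Monic → D.CubeFree →
      IsCoprime D (P * B) → D.radDeg + P.natDegree = d →
      (P ^ k * D).Monic ∧ (P ^ k * D).CubeFree ∧ IsCoprime (P ^ k * D) B ∧
        (P ^ k * D).radDeg = d := by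
    intro k hk0 hk D hm hc hDPB hr
    have hPD : ¬P ∣ D := hirr.coprime_iff_not_dvd.1 hDPB.of_mul_right_left.symm
    exact ⟨(hP.pow k).mul hm, hc.pow_mul hP hirr hPD hk,
      hcop.pow_left.mul_left hDPB.of_mul_right_right,
      (radDeg_pow_mul hP hirr hm.ne_zero hPD hk0).trans hr⟩
  ext D
  constructor
  · rintro ⟨hm, hc, hDB, hr⟩
    obtain ⟨E, hDE, hPE⟩ :=
      (FiniteMultiplicity.of_not_isUnit hirr.not_isUnit hm.ne_zero).exists_eq_pow_mul_and_not_dvd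
    generalize multiplicity P D = k at hDE
    have hk : k < 3 := by
      by_contra! h
      exact hc P hP hirr ((pow_dvd_pow P h).trans (Dvd.intro _ hDE.symm))
    subst hDE
    have hEm : E.Monic := (hP.pow k).of_mul_monic_left hm
    have hEc : E.CubeFree := hc.of_dvd (dvd_mul_left _ _)
    have hEB : IsCoprime E (P * B) :=
      (hirr.coprime_iff_not_dvd.2 hPE).symm.mul_right hDB.of_mul_left_right
    by_cases hk0 : k = 0
    · subst hk0
      rw [pow_zero, one_mul] at hr ⊢
      exact Or.inl ⟨hEm, hEc, hEB, hr⟩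
    · rw [radDeg_pow_mul hP hirr hEm.ne_zero hPE hk0] at hr
      obtain rfl | rfl : k = 1 ∨ k = 2 := by omega
      · exact Or.inr (Or.inl ⟨E, ⟨hEm, hEc, hEB, hr⟩, rfl⟩)
      · exact Or.inr (Or.inr ⟨E, ⟨hEm, hEc, hEB, hr⟩, rfl⟩)
  · rintro (⟨hm, hc, hDPB, hr⟩ | ⟨E, ⟨hm, hc, hDPB, hr⟩, rfl⟩ | ⟨E, ⟨hm, hc, hDPB, hr⟩, rfl⟩)
    · exact ⟨hm, hc, hDPB.of_mul_right_right, hr⟩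
    · exact hback 1 one_ne_zero (by norm_num) E hm hc hDPB hr
    · exact hback 2 two_ne_zero (by norm_num) E hm hc hDPB hr

/-- Splitting a weighted sum over monic cube-free polynomials coprime to `B` by the exact power
of `P` dividing them. -/
theorem finsum_cubeFree_eq_add [Finite Fq] {B P : Fq[X]} (hP : P.Monic) (hirr : Irreducible P)
    (hPB : ¬P ∣ B) (d : ℕ) (z : ℂ) :
    ∑ᶠ D ∈ {D : Fq[X] | D.Monic ∧ D.CubeFree ∧ IsCoprime D B ∧ D.radDeg = d},
        z ^ D.natDegree =
      ∑ᶠ D ∈ {D : Fq[X] | D.Monic ∧ D.CubeFree ∧ IsCoprime D (P * B) ∧ D.radDeg = d},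
        z ^ D.natDegree +
      (z ^ P.natDegree + z ^ (2 * P.natDegree)) *
        ∑ᶠ D ∈ {D : Fq[X] | D.Monic ∧ D.CubeFree ∧ IsCoprime D (P * B) ∧
          D.radDeg + P.natDegree = d}, z ^ D.natDegree := by
  rw [setOf_cubeFree_eq_union hP hirr hPB d]
  set S := {D : Fq[X] | D.Monic ∧ D.CubeFree ∧ IsCoprime D (P * B) ∧ D.radDeg = d}
  set R := {D : Fq[X] | D.Monic ∧ D.CubeFree ∧ IsCoprime D (P * B) ∧
    D.radDeg + P.natDegree = d} with hR
  have hSfin : S.Finite := finite_setOf_cubeFree_radDeg (P * B) d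
  have hRfin : R.Finite :=
    (finite_setOf_cubeFree_radDeg (P * B) (d - P.natDegree)).subset
      fun D ⟨hm, hc, hD, hr⟩ => ⟨hm, hc, hD, by omega⟩
  have hSP : ∀ D ∈ S, ¬P ∣ D := fun D hD =>
    hirr.coprime_iff_not_dvd.1 hD.2.2.1.of_mul_right_left.symm
  have hRP : ∀ D ∈ R, ¬P ∣ D := fun D hD =>
    hirr.coprime_iff_not_dvd.1 hD.2.2.1.of_mul_right_left.symm
  have hsum : ∀ k : ℕ, ∑ᶠ D ∈ (fun D => P ^ k * D) '' R, z ^ D.natDegree =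
      z ^ (k * P.natDegree) * ∑ᶠ D ∈ R, z ^ D.natDegree := by
    intro k
    rw [finsum_mem_image (mul_right_injective₀ (pow_ne_zero k hirr.ne_zero)).injOn,
      mul_finsum_mem]
    refine finsum_mem_congr rfl fun D hD => ?_
    rw [(hP.pow k).natDegree_mul hD.1, hP.natDegree_pow, pow_add]
  have hdisj₁ : Disjoint S ((fun D => P ^ 1 * D) '' R ∪ (fun D => P ^ 2 * D) '' R) := by
    rw [Set.disjoint_left]
    rintro _ hS (⟨E, -, rfl⟩ | ⟨E, -, rfl⟩)
    · exact hSP _ hS ((dvd_pow_self P one_ne_zero).mul_right E)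
    · exact hSP _ hS ((dvd_pow_self P two_ne_zero).mul_right E)
  have hdisj₂ : Disjoint ((fun D => P ^ 1 * D) '' R) ((fun D => P ^ 2 * D) '' R) := by
    rw [Set.disjoint_left]
    rintro _ ⟨E, hE, rfl⟩ ⟨F, -, hF⟩
    refine hRP E hE ⟨F, mul_left_cancel₀ hirr.ne_zero ?_⟩
    linear_combination -hF
  rw [finsum_mem_union hdisj₁ hSfin ((hRfin.image _).union (hRfin.image _)),
    finsum_mem_union hdisj₂ (hRfin.image _) (hRfin.image _), hsum, hsum, one_mul, add_mul]

end Polynomial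

section Recursion

variable {Fq : Type*} [Field Fq] [Finite Fq] [DecidableEq Fq] {B P : Fq[X]}

theorem cubeFreeWeightedSum_mul_of_lt (hP : P.Monic) (hirr : Irreducible P) (hPB : ¬P ∣ B)
    {d : ℕ} (hd : d < P.natDegree) :
    cubeFreeWeightedSum (P * B) d = cubeFreeWeightedSum B d := by
  have hempty : {D : Fq[X] | D.Monic ∧ D.CubeFree ∧ IsCoprime D (P * B) ∧
      D.radDeg + P.natDegree = d} = ∅ :=
    Set.eq_empty_of_forall_notMem fun D ⟨_, _, _, hr⟩ => by omega
  unfold cubeFreeWeightedSum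
  rw [finsum_cubeFree_eq_add hP hirr hPB, hempty, finsum_mem_empty, mul_zero, add_zero]

theorem cubeFreeWeightedSum_mul_of_le (hP : P.Monic) (hirr : Irreducible P) (hPB : ¬P ∣ B)
    {d : ℕ} (hd : P.natDegree ≤ d) :
    cubeFreeWeightedSum (P * B) d = cubeFreeWeightedSum B d -
      (Complex.exp (2 * Real.pi * Complex.I / 3) ^ P.natDegree +
        Complex.exp (2 * Real.pi * Complex.I / 3) ^ (2 * P.natDegree)) *
      cubeFreeWeightedSum (P * B) (d - P.natDegree) := by
  have hset : {D : Fq[X] | D.Monic ∧ D.CubeFree ∧ IsCoprime D (P * B) ∧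
      D.radDeg + P.natDegree = d} =
      {D : Fq[X] | D.Monic ∧ D.CubeFree ∧ IsCoprime D (P * B) ∧
        D.radDeg = d - P.natDegree} := by
    simp only [eq_tsub_iff_add_eq_of_le hd]
  unfold cubeFreeWeightedSum
  rw [finsum_cubeFree_eq_add hP hirr hPB, hset, add_sub_cancel_right]

end Recursion

/-- The `j = 1` case of Lemma 4.7 of the paper: for a monic irreducible `P ∤ B` of
degree `m`, `W_d(PB) = ∑_{a=0}^{⌊d/m⌋} (-1)^a (ω^m + ω^{2m})^a W_{d-am}(B)`,
where `ω = e^{2πi/3}`. -/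
theorem cubefree_weighted_sum_remove_prime
    (Fq : Type*) [Field Fq] [Fintype Fq] [DecidableEq Fq]
    (B : Fq[X]) (hB : B ≠ 0) (P : Fq[X]) (hP : P.Monic) (hirr : Irreducible P)
    (hPB : ¬P ∣ B) (d : ℕ) :
    cubeFreeWeightedSum (P * B) d =
      ∑ a ∈ Finset.range (d / P.natDegree + 1),
        (-1 : ℂ) ^ a *
          (Complex.exp (2 * Real.pi * Complex.I / 3) ^ P.natDegree +
            Complex.exp (2 * Real.pi * Complex.I / 3) ^ (2 * P.natDegree)) ^ a *
          cubeFreeWeightedSum B (d - a * P.natDegree) := by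
  have hm : 0 < P.natDegree := hirr.natDegree_pos
  induction d using Nat.strong_induction_on with
  | _ d ih =>
    rcases lt_or_ge d P.natDegree with hd | hd
    · rw [cubeFreeWeightedSum_mul_of_lt hP hirr hPB hd, Nat.div_eq_of_lt hd]
      simp
    · rw [cubeFreeWeightedSum_mul_of_le hP hirr hPB hd, ih _ (by omega),
        Nat.div_eq_sub_div hm hd, Finset.sum_range_succ' _ ((d - P.natDegree) / P.natDegree + 1),
        Finset.mul_sum, sub_eq_neg_add, ← Finset.sum_neg_distrib]
      congr 1
      · refine Finset.sum_congr rfl fun a _ => ?_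
        rw [add_one_mul, Nat.sub_sub, add_comm P.natDegree]
        ring
      · simp
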